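/- arXiv:1804.10353 — 2 statements merged into one kernel-verified Lean document; each statement's English description precedes it below -/
import Mathlib

section
/- Let I be a matching instance, σ an offering order on I, and e=(p,q)=σ(1) the first offer. (a) If qopt(I)(q)≠p (q is unmatched in qopt(I) or matched to a firm other than p), then sfda(I,σ)=sfda(I∖e,σ∖e). (b) If qopt(I)(q)=p, then sfda(I,σ)=sfda(I/e,σ/e)+e. -/
namespace SeqMatching

/-- A matching instance `I = (P, Q, E, ≻)`: firms `P`, workers `Q`, a finite set `E`
of acceptable pairs, and strict preferences encoded by rank functions
(lower rank = more preferred), injective on acceptable partners.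
For a firm `p`, `q ≻_p q'` means `rankP p q < rankP p q'`; symmetrically for workers. -/
structure MI (P Q : Type) where
  E : Finset (P × Q)
  rankP : P → Q → ℕ
  rankQ : Q → P → ℕ
  injP : ∀ p q q', (p, q) ∈ E → (p, q') ∈ E → rankP p q = rankP p q' → q = q'
  injQ : ∀ q p p', (p, q) ∈ E → (p', q) ∈ E → rankQ q p = rankQ q p' → p = p'

namespace MI

variable {P Q : Type}

/-- `μ` is a matching in `I`: a subset of `E` in which every firm and every worker
occurs in at most one pair. -/
def IsMatching (I : MI P Q) (μ : Finset (P × Q)) : Prop :=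
  μ ⊆ I.E ∧ ∀ e ∈ μ, ∀ f ∈ μ, (e.1 = f.1 ∨ e.2 = f.2) → e = f

/-- `μ(q) ⪰_q p`: worker `q` is matched in `μ` to `p` or to a firm she strictly prefers to `p`. -/
def WAtLeast (I : MI P Q) (μ : Finset (P × Q)) (q : Q) (p : P) : Prop :=
  ∃ p', (p', q) ∈ μ ∧ (p' = p ∨ I.rankQ q p' < I.rankQ q p)

/-- `p ≻_q μ(q)`: worker `q` is unmatched in `μ` or matched to a firm strictly less preferred than `p`. -/
def WBelow (I : MI P Q) (μ : Finset (P × Q)) (q : Q) (p : P) : Prop :=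
  ∀ p', (p', q) ∈ μ → I.rankQ q p < I.rankQ q p'

/-- `q ≻_p μ(p)`: firm `p` is unmatched in `μ` or matched to a worker strictly less preferred than `q`. -/
def FBelow (I : MI P Q) (μ : Finset (P × Q)) (p : P) (q : Q) : Prop :=
  ∀ q', (p, q') ∈ μ → I.rankP p q < I.rankP p q'

/-- the acceptable pair `e = (p, q)` blocks `μ`. -/
def Blocks (I : MI P Q) (μ : Finset (P × Q)) (e : P × Q) : Prop :=
  e ∈ I.E ∧ I.FBelow μ e.1 e.2 ∧ I.WBelow μ e.2 e.1

/-- `μ` is a stable matching in `I`. -/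
def IsStable (I : MI P Q) (μ : Finset (P × Q)) : Prop :=
  I.IsMatching μ ∧ ∀ e, ¬ I.Blocks μ e

/-- `μ(q) ⪰_q μ'(q)`: worker `q` weakly prefers `μ` to `μ'`. -/
def WGe (I : MI P Q) (μ μ' : Finset (P × Q)) (q : Q) : Prop :=
  ∀ p', (p', q) ∈ μ' → I.WAtLeast μ q p'

/-- `μ` is the Q-optimal (worker-optimal) stable matching of `I`. -/
def IsQOpt (I : MI P Q) (μ : Finset (P × Q)) : Prop :=
  I.IsStable μ ∧ ∀ μ', I.IsStable μ' → ∀ q, I.WGe μ μ' q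

open scoped Classical in
/-- the Q-optimal stable matching `qopt(I)` (it exists and is unique by Gale–Shapley). -/
noncomputable def qopt (I : MI P Q) : Finset (P × Q) :=
  if h : ∃ μ, I.IsQOpt μ then h.choose else ∅

/-- `q` is the most preferred worker on `p`'s list. -/
def TopForFirm (I : MI P Q) (p : P) (q : Q) : Prop :=
  (p, q) ∈ I.E ∧ ∀ q', (p, q') ∈ I.E → I.rankP p q ≤ I.rankP p q'

/-- `p` is the most preferred firm on `q`'s list. -/
def TopForWorker (I : MI P Q) (q : Q) (p : P) : Prop :=
  (p, q) ∈ I.E ∧ ∀ p', (p', q) ∈ I.E → I.rankQ q p ≤ I.rankQ q p'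

variable [DecidableEq P] [DecidableEq Q]

/-- a (2,∞)-instance: every firm has at most two acceptable workers. -/
def FirmsDegTwo (I : MI P Q) : Prop :=
  ∀ p : P, (I.E.filter (fun f => f.1 = p)).card ≤ 2

/-- an (∞,2)-instance: every worker has at most two acceptable firms. -/
def WorkersDegTwo (I : MI P Q) : Prop :=
  ∀ q : Q, (I.E.filter (fun f => f.2 = q)).card ≤ 2

/-- the deletion `I ∖ e`. -/
def del (I : MI P Q) (e : P × Q) : MI P Q where
  E := I.E.erase e
  rankP := I.rankP
  rankQ := I.rankQ
  injP := fun p q q' h h' hr =>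
    I.injP p q q' (Finset.mem_of_mem_erase h) (Finset.mem_of_mem_erase h') hr
  injQ := fun q p p' h h' hr =>
    I.injQ q p p' (Finset.mem_of_mem_erase h) (Finset.mem_of_mem_erase h') hr

/-- the contraction `I / e`: all pairs containing the firm or the worker of `e` are removed. -/
def contr (I : MI P Q) (e : P × Q) : MI P Q where
  E := I.E.filter (fun f => f.1 ≠ e.1 ∧ f.2 ≠ e.2)
  rankP := I.rankP
  rankQ := I.rankQ
  injP := fun p q q' h h' hr =>
    I.injP p q q' (Finset.filter_subset _ _ h) (Finset.filter_subset _ _ h') hr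
  injQ := fun q p p' h h' hr =>
    I.injQ q p p' (Finset.filter_subset _ _ h) (Finset.filter_subset _ _ h') hr

/-- `σ` is an offering order on `I`: an enumeration of `E` without repetition, consistent
with the firms' preferences (if `e ≻_p f` for two offers of the same firm, `e` comes first). -/
def IsOfferOrder (I : MI P Q) (σ : List (P × Q)) : Prop :=
  σ.Nodup ∧ (∀ e, e ∈ σ ↔ e ∈ I.E) ∧
    ∀ e f, e ∈ σ → f ∈ σ → e.1 = f.1 → I.rankP e.1 e.2 < I.rankP f.1 f.2 →
      σ.idxOf e < σ.idxOf f

/-- restriction `σ / e` of the order `σ` to the pairs of `I / e`. -/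
def contrO (σ : List (P × Q)) (e : P × Q) : List (P × Q) :=
  σ.filter (fun f => decide (f.1 ≠ e.1 ∧ f.2 ≠ e.2))

theorem qopt_subset (I : MI P Q) : I.qopt ⊆ I.E := by
  unfold qopt
  split
  · next h => exact h.choose_spec.1.1.1
  · exact Finset.empty_subset _

/-- the sequentially fixing deferred acceptance algorithm: repeatedly fix the pair of
`qopt` of the current instance that comes first in the offering order. -/
noncomputable def sfda (I : MI P Q) (σ : List (P × Q)) : Finset (P × Q) :=
  match h : σ.find? (fun f => decide (f ∈ I.qopt)) with
  | none => ∅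
  | some e => insert e ((I.contr e).sfda (contrO σ e))
termination_by σ.length
decreasing_by
  have he : e ∈ σ := List.mem_of_find?_eq_some h
  have hfail : ¬ (fun f => decide (f.1 ≠ e.1 ∧ f.2 ≠ e.2)) e = true := by simp
  exact List.length_filter_lt_length_iff_exists.mpr ⟨e, he, hfail⟩

open scoped Classical in
/-- the SPE matching `spe(I, σ)` of the sequential matching game `(I, σ)`. -/
noncomputable def spe (I : MI P Q) (σ : List (P × Q)) : Finset (P × Q) :=
  match σ with
  | [] => ∅
  | e :: rest =>
    if I.WBelow ((I.del e).spe rest) e.2 e.1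
    then insert e ((I.contr e).spe (contrO rest e))
    else (I.del e).spe rest
termination_by σ.length
decreasing_by
  all_goals simp only [contrO, List.length_cons]
  all_goals first
    | omega
    | exact Nat.lt_succ_of_le (List.length_filter_le _ _)


theorem isQOpt_unique (I : MI P Q) {μ ν : Finset (P × Q)} (hμ : I.IsQOpt μ) (hν : I.IsQOpt ν) :
    μ = ν := by
  have key : ∀ μ ν : Finset (P × Q), I.IsQOpt μ → I.IsQOpt ν → ∀ e ∈ μ, e ∈ ν := by
    rintro μ ν hμ hν ⟨a, b⟩ he
    obtain ⟨a', ha', h1⟩ := hν.2 μ hμ.1 b a he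
    obtain ⟨a'', ha'', h2⟩ := hμ.2 ν hν.1 b a' ha'
    have h3 : a'' = a := by
      have := hμ.1.1.2 _ ha'' _ he (Or.inr rfl)
      exact (Prod.mk.inj this).1
    subst h3
    rcases h1 with h1 | h1
    · subst h1; exact ha'
    · rcases h2 with h2 | h2
      · subst h2; exact ha'
      · omega
  ext e
  exact ⟨key μ ν hμ hν e, key ν μ hν hμ e⟩

theorem exists_isQOpt (n : ℕ) : ∀ I : MI P Q, I.E.card = n → ∃ μ, I.IsQOpt μ := by
  classical
  induction n using Nat.strong_induction_on with
  | _ n ih =>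
  intro I hn
  by_cases hc : ∃ p q q', I.TopForWorker q p ∧ I.TopForWorker q' p ∧ I.rankP p q < I.rankP p q'
  · obtain ⟨p, q, q', h1, h2, hlt⟩ := hc
    have hne : (p, q) ≠ (p, q') := by
      intro h; rw [(Prod.mk.inj h).2] at hlt; omega
    have hcard : (I.del (p, q')).E.card < n := by
      rw [← hn]; exact Finset.card_erase_lt_of_mem h2.1
    obtain ⟨μ, hμ⟩ := ih _ hcard (I.del (p, q')) rfl
    refine ⟨μ, ?_, ?_⟩
    · refine ⟨⟨fun x hx => Finset.mem_of_mem_erase (hμ.1.1.1 hx), hμ.1.1.2⟩, ?_⟩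
      rintro ⟨a, b⟩ ⟨hE, hF, hW⟩
      by_cases hab : (a, b) = (p, q')
      · obtain ⟨rfl, rfl⟩ := Prod.mk.inj hab
        refine hμ.1.2 (a, q) ⟨Finset.mem_erase.2 ⟨hne, h1.1⟩, ?_, ?_⟩
        · intro c hc
          exact lt_trans hlt (hF c hc)
        · intro c hc
          have hcE : (c, q) ∈ I.E := Finset.mem_of_mem_erase (hμ.1.1.1 hc)
          have h3 := h1.2 c hcE
          rcases Nat.lt_or_ge (I.rankQ q a) (I.rankQ q c) with h | h
          · exact h
          · have : a = c := I.injQ q a c h1.1 hcE (le_antisymm h3 h)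
            subst this
            have := hF q hc
            dsimp only at this
            omega
      · exact hμ.1.2 (a, b) ⟨Finset.mem_erase.2 ⟨hab, hE⟩, hF, hW⟩
    · intro ν hν
      refine hμ.2 ν ⟨⟨?_, hν.1.2⟩, ?_⟩
      · intro x hx
        refine Finset.mem_erase.2 ⟨?_, hν.1.1 hx⟩
        rintro rfl
        refine hν.2 (p, q) ⟨h1.1, ?_, ?_⟩
        · intro c hc
          have := hν.1.2 _ hc _ hx (Or.inl rfl)
          rw [(Prod.mk.inj this).2]
          exact hlt
        · intro c hc
          have hcE : (c, q) ∈ I.E := hν.1.1 hc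
          rcases Nat.lt_or_ge (I.rankQ q p) (I.rankQ q c) with h | h
          · exact h
          · have h4 : p = c := I.injQ q p c h1.1 hcE (le_antisymm (h1.2 c hcE) h)
            subst h4
            exact absurd (hν.1.2 _ hc _ hx (Or.inl rfl)) hne
      · rintro e ⟨hE, hF, hW⟩
        exact hν.2 e ⟨Finset.mem_of_mem_erase hE, hF, hW⟩
  · have htop : ∀ a b, (a, b) ∈ I.E → ∃ c, I.TopForWorker b c := by
      intro a b hab
      obtain ⟨x, hx, hmin⟩ := Finset.exists_min_image (I.E.filter (fun f => f.2 = b))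
        (fun f => I.rankQ b f.1) ⟨(a, b), by simp [hab]⟩
      obtain ⟨x1, x2⟩ := x
      simp only [Finset.mem_filter] at hx
      obtain ⟨hx, rfl⟩ := hx
      refine ⟨x1, hx, fun c hc => hmin (c, x2) (by simp [hc])⟩
    refine ⟨I.E.filter (fun f => I.TopForWorker f.2 f.1), ⟨⟨Finset.filter_subset _ _, ?_⟩, ?_⟩, ?_⟩
    · rintro ⟨a, b⟩ he ⟨c, d⟩ hf h
      simp only [Finset.mem_filter] at he hf h
      rcases h with rfl | rfl
      · have h1 : ¬ I.rankP a b < I.rankP a d := fun h => hc ⟨a, b, d, he.2, hf.2, h⟩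
        have h2 : ¬ I.rankP a d < I.rankP a b := fun h => hc ⟨a, d, b, hf.2, he.2, h⟩
        rw [I.injP a b d he.1 hf.1 (by omega)]
      · rw [I.injQ b a c he.1 hf.1 (le_antisymm (he.2.2 c hf.1) (hf.2.2 a he.1))]
    · rintro ⟨a, b⟩ ⟨hE, hF, hW⟩
      obtain ⟨c, hcT⟩ := htop a b hE
      have := hW c (Finset.mem_filter.2 ⟨hcT.1, hcT⟩)
      have := hcT.2 a hE
      dsimp only at *
      omega
    · intro ν hν b a hab
      obtain ⟨c, hcT⟩ := htop a b (hν.1.1 hab)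
      refine ⟨c, Finset.mem_filter.2 ⟨hcT.1, hcT⟩, ?_⟩
      rcases Nat.lt_or_ge (I.rankQ b c) (I.rankQ b a) with h | h
      · exact Or.inr h
      · exact Or.inl (I.injQ b c a hcT.1 (hν.1.1 hab) (le_antisymm (hcT.2 a (hν.1.1 hab)) h))

theorem qopt_spec (I : MI P Q) : I.IsQOpt I.qopt := by
  have h := exists_isQOpt _ I rfl
  unfold qopt
  rw [dif_pos h]
  exact h.choose_spec

theorem sfda_none (I : MI P Q) (σ : List (P × Q))
    (h : σ.find? (fun f => decide (f ∈ I.qopt)) = none) : I.sfda σ = ∅ := by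
  rw [sfda]
  split
  · rfl
  · next e he => rw [h] at he; cases he

theorem sfda_some (I : MI P Q) (σ : List (P × Q)) (e : P × Q)
    (h : σ.find? (fun f => decide (f ∈ I.qopt)) = some e) :
    I.sfda σ = insert e ((I.contr e).sfda (contrO σ e)) := by
  rw [sfda]
  split
  · next he => rw [h] at he; cases he
  · next e' he => rw [h] at he; cases he; rfl

theorem ext_of (I J : MI P Q) (h1 : I.E = J.E) (h2 : I.rankP = J.rankP)
    (h3 : I.rankQ = J.rankQ) : I = J := by
  cases I; cases J; cases h1; cases h2; cases h3; rfl

/-- If the firm's top offer is not in a stable matching, its worker is matched strictly better. -/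
theorem better_of_top (I : MI P Q) {p : P} {q : Q} (ht : I.TopForFirm p q)
    {μ : Finset (P × Q)} (hμ : I.IsStable μ) (hn : (p, q) ∉ μ) :
    ∃ p', (p', q) ∈ μ ∧ I.rankQ q p' < I.rankQ q p := by
  by_contra hcon
  push Not at hcon
  refine hμ.2 (p, q) ⟨ht.1, ?_, ?_⟩
  · intro c hc
    have hE := hμ.1.1 hc
    refine lt_of_le_of_ne (ht.2 c hE) fun h => hn ?_
    rw [I.injP p q c ht.1 hE h]; exact hc
  · intro c hc
    have hE := hμ.1.1 hc
    refine lt_of_le_of_ne (hcon c hc) fun h => hn ?_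
    have h' : p = c := I.injQ q p c ht.1 hE h
    rw [h']; exact hc

theorem qopt_del (I : MI P Q) {p : P} {q : Q} (ht : I.TopForFirm p q)
    (hn : (p, q) ∉ I.qopt) : (I.del (p, q)).qopt = I.qopt := by
  have h0 := I.qopt_spec
  have h1 := (I.del (p, q)).qopt_spec
  have hs : (I.del (p, q)).IsStable I.qopt := by
    refine ⟨⟨?_, h0.1.1.2⟩, ?_⟩
    · intro x hx
      refine Finset.mem_erase.2 ⟨?_, h0.1.1.1 hx⟩
      rintro rfl; exact hn hx
    · rintro e ⟨hE, hF, hW⟩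
      exact h0.1.2 e ⟨Finset.mem_of_mem_erase hE, hF, hW⟩
  refine isQOpt_unique I ⟨⟨⟨?_, h1.1.1.2⟩, ?_⟩, ?_⟩ h0
  · exact fun x hx => Finset.mem_of_mem_erase (h1.1.1.1 hx)
  · rintro e ⟨hE, hF, hW⟩
    by_cases he : e = (p, q)
    · subst he
      obtain ⟨p', hp', hlt⟩ := better_of_top I ht h0.1 hn
      obtain ⟨p'', hp'', h⟩ := h1.2 _ hs q p' hp'
      have h5 := hW p'' hp''
      dsimp only at h5
      rcases h with rfl | h
      · omega
      · change I.rankQ q p'' < I.rankQ q p' at h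
        omega
    · exact h1.1.2 e ⟨Finset.mem_erase.2 ⟨he, hE⟩, hF, hW⟩
  · intro ν hν b a hab
    obtain ⟨c, hc, h⟩ := h0.2 ν hν b a hab
    obtain ⟨d, hd, h'⟩ := h1.2 _ hs b c hc
    refine ⟨d, hd, ?_⟩
    change d = c ∨ I.rankQ b d < I.rankQ b c at h'
    rcases h with rfl | h
    · exact h'
    · rcases h' with rfl | h'
      · exact Or.inr h
      · exact Or.inr (h'.trans h)

theorem isStable_contr (I : MI P Q) {μ : Finset (P × Q)} (hμ : I.IsStable μ) {f : P × Q}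
    (hf : f ∈ μ) : (I.contr f).IsStable (μ.erase f) := by
  refine ⟨⟨?_, ?_⟩, ?_⟩
  · intro x hx
    obtain ⟨hxf, hx⟩ := Finset.mem_erase.1 hx
    refine Finset.mem_filter.2 ⟨hμ.1.1 hx, ?_, ?_⟩
    · exact fun h => hxf (hμ.1.2 _ hx _ hf (Or.inl h))
    · exact fun h => hxf (hμ.1.2 _ hx _ hf (Or.inr h))
  · intro x hx y hy h
    exact hμ.1.2 x (Finset.mem_of_mem_erase hx) y (Finset.mem_of_mem_erase hy) h
  · rintro ⟨a, b⟩ ⟨hE, hF, hW⟩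
    obtain ⟨hE, h1, h2⟩ := Finset.mem_filter.1 hE
    refine hμ.2 (a, b) ⟨hE, ?_, ?_⟩
    · intro c hc
      exact hF c (Finset.mem_erase.2 ⟨by rintro rfl; exact h1 rfl, hc⟩)
    · intro c hc
      exact hW c (Finset.mem_erase.2 ⟨by rintro rfl; exact h2 rfl, hc⟩)

theorem sfda_del (n : ℕ) : ∀ (I : MI P Q) (ρ : List (P × Q)) (p : P) (q : Q), ρ.length = n →
    I.TopForFirm p q → (p, q) ∉ I.qopt →
    I.sfda ((p, q) :: ρ) = (I.del (p, q)).sfda ρ := by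
  induction n using Nat.strong_induction_on with
  | _ n ih =>
  intro I ρ p q hlen ht hn
  have hq := qopt_del I ht hn
  have hfind : ((p, q) :: ρ).find? (fun f => decide (f ∈ I.qopt)) =
      ρ.find? (fun f => decide (f ∈ (I.del (p, q)).qopt)) := by
    rw [hq, List.find?_cons_of_neg (by simpa using hn)]
  rcases hr : ρ.find? (fun f => decide (f ∈ (I.del (p, q)).qopt)) with _ | f
  · rw [sfda_none _ _ hr, sfda_none _ _ (hfind.trans hr)]
  · rw [sfda_some _ _ _ hr, sfda_some _ _ _ (hfind.trans hr)]
    congr 1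
    have hfρ : f ∈ ρ := List.mem_of_find?_eq_some hr
    have hfμ : f ∈ I.qopt := by
      have := List.find?_some hr
      rw [hq] at this
      simpa using this
    by_cases hd : p ≠ f.1 ∧ q ≠ f.2
    · have hcO : contrO ((p, q) :: ρ) f = (p, q) :: contrO ρ f := by
        unfold contrO
        rw [List.filter_cons_of_pos (by simpa using hd)]
      have hdc : (I.del (p, q)).contr f = (I.contr f).del (p, q) := by
        refine ext_of _ _ ?_ rfl rfl
        ext x
        simp only [contr, del, Finset.mem_filter, Finset.mem_erase]
        tauto
      rw [hcO, hdc]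
      refine ih _ ?_ (I.contr f) (contrO ρ f) p q rfl ?_ ?_
      · rw [← hlen]
        exact List.length_filter_lt_length_iff_exists.mpr ⟨f, hfρ, by simp⟩
      · exact ⟨Finset.mem_filter.2 ⟨ht.1, hd⟩, fun c hc => ht.2 c (Finset.mem_filter.1 hc).1⟩
      · intro hmem
        have h1 := (I.contr f).qopt_spec
        obtain ⟨p', hp', hlt⟩ := better_of_top I ht I.qopt_spec.1 hn
        have hs := isStable_contr I I.qopt_spec.1 hfμ
        obtain ⟨p'', hp'', h⟩ := h1.2 _ hs q p'
          (Finset.mem_erase.2 ⟨by rintro rfl; exact hd.2 rfl, hp'⟩)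
        have h2 := (Prod.mk.inj (h1.1.1.2 _ hp'' _ hmem (Or.inr rfl))).1
        subst h2
        change p'' = p' ∨ I.rankQ q p'' < I.rankQ q p' at h
        rcases h with rfl | h <;> omega
    · have hcO : contrO ((p, q) :: ρ) f = contrO ρ f := by
        unfold contrO
        rw [List.filter_cons_of_neg (by simpa using hd)]
      have hdc : (I.del (p, q)).contr f = I.contr f := by
        refine ext_of _ _ ?_ rfl rfl
        ext x
        simp only [contr, del, Finset.mem_filter, Finset.mem_erase]
        constructor
        · tauto
        · rintro ⟨hx, hx2⟩
          refine ⟨⟨?_, hx⟩, hx2⟩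
          rintro rfl
          exact hd hx2
      rw [hcO, hdc]

/-- for the first offer `e = (p, q) = σ(1)`:
(a) if `qopt(I)(q) ≠ p` then `sfda(I, σ) = sfda(I ∖ e, σ ∖ e)`;
(b) if `qopt(I)(q) = p` then `sfda(I, σ) = sfda(I/e, σ/e) + e`. -/
theorem stmt_6 (P Q : Type) [DecidableEq P] [DecidableEq Q] (I : MI P Q)
    (σ : List (P × Q)) (hσ : I.IsOfferOrder σ) (p : P) (q : Q)
    (hhead : σ.head? = some (p, q))
    (μ₀ : Finset (P × Q)) (h₀ : I.IsQOpt μ₀) :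
    ((p, q) ∉ μ₀ → I.sfda σ = (I.del (p, q)).sfda (σ.erase (p, q))) ∧
    ((p, q) ∈ μ₀ → I.sfda σ = insert (p, q) ((I.contr (p, q)).sfda (contrO σ (p, q)))) := by
  have hq : μ₀ = I.qopt := isQOpt_unique I h₀ I.qopt_spec
  subst hq
  obtain ⟨ρ, rfl⟩ : ∃ ρ, σ = (p, q) :: ρ := by
    cases σ with
    | nil => simp at hhead
    | cons a ρ => simp at hhead; exact ⟨ρ, by rw [hhead]⟩
  constructor
  · intro hn
    rw [List.erase_cons_head]
    have hE : (p, q) ∈ I.E := (hσ.2.1 _).1 List.mem_cons_self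
    refine sfda_del _ I ρ p q rfl ⟨hE, ?_⟩ hn
    intro c hc
    by_contra hlt
    have := hσ.2.2 (p, c) (p, q) ((hσ.2.1 _).2 hc) List.mem_cons_self rfl (not_le.1 hlt)
    simp at this
  · intro hm
    exact sfda_some _ _ _ (List.find?_cons_of_pos (by simpa using hm))

end MI

end SeqMatching
end

section
/- For any matching instance I, any offering order σ on I, and any agent r ∈ P ∪ Q: the agent r is matched in sfda(I,σ) if and only if r is matched in qopt(I). -/
namespace SeqMatching

namespace MI

variable {P Q : Type}

variable [DecidableEq P] [DecidableEq Q]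

/-- the join of two matchings: every worker takes the better partner. -/
def join (I : MI P Q) (μ μ' : Finset (P × Q)) : Finset (P × Q) :=
  (μ ∪ μ').filter (fun e => ∀ f ∈ μ ∪ μ', f.2 = e.2 → I.rankQ e.2 e.1 ≤ I.rankQ f.2 f.1)

theorem join_comm (I : MI P Q) (μ μ' : Finset (P × Q)) : I.join μ μ' = I.join μ' μ := by
  unfold join
  rw [Finset.union_comm]

theorem exists_join (I : MI P Q) (μ μ' : Finset (P × Q)) (f : P × Q) (hf : f ∈ μ ∪ μ') :
    ∃ p, (p, f.2) ∈ I.join μ μ' ∧ I.rankQ f.2 p ≤ I.rankQ f.2 f.1 := by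
  obtain ⟨g, hg, hmin⟩ := Finset.exists_min_image ((μ ∪ μ').filter (fun g => g.2 = f.2))
    (fun g => I.rankQ g.2 g.1) ⟨f, Finset.mem_filter.2 ⟨hf, rfl⟩⟩
  rw [Finset.mem_filter] at hg
  obtain ⟨hg, hg2⟩ := hg
  refine ⟨g.1, ?_, ?_⟩
  · rw [← hg2]
    unfold join
    rw [Finset.mem_filter]
    refine ⟨hg, fun k hk hk2 => hmin k ?_⟩
    rw [Finset.mem_filter]
    exact ⟨hk, hk2.trans hg2⟩
  · have := hmin f (by rw [Finset.mem_filter]; exact ⟨hf, rfl⟩)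
    simpa [hg2] using this

theorem join_le (I : MI P Q) {μ μ' : Finset (P × Q)} {p p' : P} {q : Q}
    (h : (p, q) ∈ I.join μ μ') (h' : (p', q) ∈ μ ∪ μ') : I.rankQ q p ≤ I.rankQ q p' := by
  unfold join at h
  rw [Finset.mem_filter] at h
  exact h.2 _ h' rfl

theorem join_mem (I : MI P Q) {μ μ' : Finset (P × Q)} {e : P × Q}
    (h : e ∈ I.join μ μ') : e ∈ μ ∨ e ∈ μ' := by
  unfold join at h
  rw [Finset.mem_filter, Finset.mem_union] at h
  exact h.1

/-- a join pair from `μ` : the firm is matched in `μ'` to a weakly better worker. -/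
theorem join_firm (I : MI P Q) {μ μ' : Finset (P × Q)} (h : I.IsStable μ) (h' : I.IsStable μ')
    {p : P} {q : Q} (hj : (p, q) ∈ I.join μ μ') (hm : (p, q) ∈ μ) :
    ∃ q', (p, q') ∈ μ' ∧ I.rankP p q' ≤ I.rankP p q := by
  by_cases hq : (p, q) ∈ μ'
  · exact ⟨q, hq, le_rfl⟩
  by_contra hcon
  push Not at hcon
  refine h'.2 (p, q) ⟨h.1.1 hm, hcon, ?_⟩
  intro p' hp'
  have hle := I.join_le hj (Finset.mem_union_right _ hp')
  rcases hle.lt_or_eq with hlt | heq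
  · exact hlt
  · have := I.injQ q p p' (h.1.1 hm) (h'.1.1 hp') heq
    subst this
    exact absurd hp' hq

theorem join_cross (I : MI P Q) {μ μ' : Finset (P × Q)} (h : I.IsStable μ) (h' : I.IsStable μ')
    {p : P} {q q' : Q} (hj : (p, q) ∈ I.join μ μ') (hj' : (p, q') ∈ I.join μ μ')
    (hm : (p, q) ∈ μ) (hm' : (p, q') ∈ μ') : q = q' := by
  obtain ⟨a, ha, hla⟩ := I.join_firm h h' hj hm
  rw [I.join_comm] at hj'
  obtain ⟨b, hb, hlb⟩ := I.join_firm h' h hj' hm'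
  have e1 := h'.1.2 _ ha _ hm' (Or.inl rfl)
  have e2 := h.1.2 _ hb _ hm (Or.inl rfl)
  simp only [Prod.mk.injEq, true_and] at e1 e2
  subst e1 e2
  exact I.injP p _ _ (h.1.1 hm) (h'.1.1 hm') (le_antisymm hlb hla)

theorem join_matching (I : MI P Q) {μ μ' : Finset (P × Q)} (h : I.IsStable μ)
    (h' : I.IsStable μ') : I.IsMatching (I.join μ μ') := by
  have hsub : ∀ e ∈ I.join μ μ', e ∈ I.E := by
    intro e he
    rcases I.join_mem he with h1 | h1
    · exact h.1.1 h1
    · exact h'.1.1 h1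
  have hun : ∀ e ∈ I.join μ μ', e ∈ μ ∪ μ' := fun e he => Finset.mem_union.2 (I.join_mem he)
  refine ⟨hsub, ?_⟩
  rintro ⟨p, q⟩ he ⟨p', q'⟩ hf (heq | heq)
  · simp only at heq
    subst heq
    rcases I.join_mem he with h1 | h1 <;> rcases I.join_mem hf with h2 | h2
    · exact h.1.2 _ h1 _ h2 (Or.inl rfl)
    · rw [I.join_cross h h' he hf h1 h2]
    · rw [I.join_cross h h' hf he h2 h1]
    · exact h'.1.2 _ h1 _ h2 (Or.inl rfl)
  · simp only at heq
    subst heq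
    rw [I.injQ q p p' (hsub _ he) (hsub _ hf)
      (le_antisymm (I.join_le he (hun _ hf)) (I.join_le hf (hun _ he)))]

theorem card_fst (I : MI P Q) {μ : Finset (P × Q)} (h : I.IsMatching μ) :
    (μ.image Prod.fst).card = μ.card :=
  Finset.card_image_of_injOn (fun e he f hf hef => h.2 e he f hf (Or.inl hef))

theorem card_snd (I : MI P Q) {μ : Finset (P × Q)} (h : I.IsMatching μ) :
    (μ.image Prod.snd).card = μ.card :=
  Finset.card_image_of_injOn (fun e he f hf hef => h.2 e he f hf (Or.inr hef))

theorem join_images (I : MI P Q) {μ μ' : Finset (P × Q)} (h : I.IsStable μ)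
    (h' : I.IsStable μ') :
    (I.join μ μ').image Prod.fst = μ.image Prod.fst ∧
    (I.join μ μ').image Prod.snd = μ.image Prod.snd := by
  have hm := I.join_matching h h'
  have h1 : (I.join μ μ').image Prod.fst ⊆ μ.image Prod.fst := by
    intro p hp
    obtain ⟨⟨p, q⟩, he, rfl⟩ := Finset.mem_image.1 hp
    rcases I.join_mem he with h1 | h1
    · exact Finset.mem_image_of_mem Prod.fst h1
    · rw [I.join_comm] at he
      obtain ⟨q', hq', -⟩ := I.join_firm h' h he h1
      exact Finset.mem_image.2 ⟨_, hq', rfl⟩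
  have h2 : μ.image Prod.snd ⊆ (I.join μ μ').image Prod.snd := by
    intro q hq
    obtain ⟨e, he, rfl⟩ := Finset.mem_image.1 hq
    obtain ⟨p, hp, -⟩ := I.exists_join μ μ' e (Finset.mem_union_left _ he)
    exact Finset.mem_image.2 ⟨_, hp, rfl⟩
  have c1 := Finset.card_le_card h1
  have c2 := Finset.card_le_card h2
  rw [I.card_fst hm, I.card_fst h.1] at c1
  rw [I.card_snd hm, I.card_snd h.1] at c2
  refine ⟨Finset.eq_of_subset_of_card_le h1 ?_, (Finset.eq_of_subset_of_card_le h2 ?_).symm⟩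
  · rw [I.card_fst hm, I.card_fst h.1]; exact c2
  · rw [I.card_snd hm, I.card_snd h.1]; exact c1

theorem rural (I : MI P Q) {μ μ' : Finset (P × Q)} (h : I.IsStable μ) (h' : I.IsStable μ') :
    μ.image Prod.fst = μ'.image Prod.fst ∧ μ.image Prod.snd = μ'.image Prod.snd := by
  have a := I.join_images h h'
  have b := I.join_images h' h
  rw [I.join_comm] at b
  exact ⟨a.1.symm.trans b.1, a.2.symm.trans b.2⟩

theorem join_stable (I : MI P Q) {μ μ' : Finset (P × Q)} (h : I.IsStable μ)
    (h' : I.IsStable μ') : I.IsStable (I.join μ μ') := by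
  refine ⟨I.join_matching h h', ?_⟩
  rintro ⟨p, q⟩ ⟨hE, hF, hW⟩
  simp only at hF hW
  have hW' : ∀ p', (p', q) ∈ μ ∪ μ' → I.rankQ q p < I.rankQ q p' := by
    intro p' hp'
    obtain ⟨p'', hj, hle⟩ := I.exists_join μ μ' _ hp'
    exact (hW p'' hj).trans_le hle
  have n1 : ¬ I.FBelow μ p q := fun hf =>
    h.2 (p, q) ⟨hE, hf, fun p' hp' => hW' p' (Finset.mem_union_left _ hp')⟩
  have n2 : ¬ I.FBelow μ' p q := fun hf =>
    h'.2 (p, q) ⟨hE, hf, fun p' hp' => hW' p' (Finset.mem_union_right _ hp')⟩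
  unfold FBelow at n1 n2
  push Not at n1 n2
  obtain ⟨q1, hq1, hr1⟩ := n1
  obtain ⟨q2, hq2, hr2⟩ := n2
  have hp : p ∈ (I.join μ μ').image Prod.fst := by
    rw [(I.join_images h h').1]
    exact Finset.mem_image.2 ⟨_, hq1, rfl⟩
  obtain ⟨⟨p, q3⟩, hj, rfl⟩ := Finset.mem_image.1 hp
  have hlt := hF q3 hj
  rcases I.join_mem hj with h3 | h3
  · have e1 := h.1.2 _ h3 _ hq1 (Or.inl rfl)
    simp only [Prod.mk.injEq, true_and] at e1
    subst e1
    exact absurd hlt (not_lt.2 hr1)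
  · have e1 := h'.1.2 _ h3 _ hq2 (Or.inl rfl)
    simp only [Prod.mk.injEq, true_and] at e1
    subst e1
    exact absurd hlt (not_lt.2 hr2)

theorem join_ge (I : MI P Q) {μ μ' : Finset (P × Q)} (h : I.IsStable μ)
    (h' : I.IsStable μ') (q : Q) : I.WGe (I.join μ μ') μ q := by
  intro p hp
  obtain ⟨p', hj, hle⟩ := I.exists_join μ μ' _ (Finset.mem_union_left _ hp)
  refine ⟨p', hj, ?_⟩
  rcases hle.lt_or_eq with hlt | heq
  · exact Or.inr hlt
  · exact Or.inl (I.injQ q p' p ((I.join_matching h h').1 hj) (h.1.1 hp) heq)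

theorem WGe_trans (I : MI P Q) {μ μ' μ'' : Finset (P × Q)} {q : Q} (h : I.WGe μ μ' q)
    (h' : I.WGe μ' μ'' q) : I.WGe μ μ'' q := by
  intro p hp
  obtain ⟨p', hp', hr⟩ := h' p hp
  obtain ⟨p'', hp'', hr'⟩ := h p' hp'
  refine ⟨p'', hp'', ?_⟩
  rcases hr with rfl | hr
  · exact hr'
  · rcases hr' with rfl | hr'
    · exact Or.inr hr
    · exact Or.inr (hr'.trans hr)

theorem exists_qopt (I : MI P Q) {μ : Finset (P × Q)} (h : I.IsStable μ) :
    ∃ ν, I.IsQOpt ν := by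
  have key : ∀ S : Finset (Finset (P × Q)), ∃ ν, I.IsStable ν ∧
      ∀ μ' ∈ S, I.IsStable μ' → ∀ q, I.WGe ν μ' q := by
    intro S
    induction S using Finset.induction with
    | empty => exact ⟨μ, h, by simp⟩
    | insert a S _ ih =>
      obtain ⟨ν, hν, hge⟩ := ih
      by_cases ha : I.IsStable a
      · refine ⟨I.join ν a, I.join_stable hν ha, ?_⟩
        intro μ' hμ' hs q
        rcases Finset.mem_insert.1 hμ' with rfl | hm
        · rw [I.join_comm]
          exact I.join_ge ha hν q
        · exact I.WGe_trans (I.join_ge hν ha q) (hge μ' hm hs q)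
      · refine ⟨ν, hν, ?_⟩
        intro μ' hμ' hs q
        rcases Finset.mem_insert.1 hμ' with rfl | hm
        · exact absurd hs ha
        · exact hge μ' hm hs q
  obtain ⟨ν, hν, hge⟩ := key I.E.powerset
  exact ⟨ν, hν, fun μ' hs => hge μ' (Finset.mem_powerset.2 hs.1.1) hs⟩

theorem qopt_stable (I : MI P Q) {μ : Finset (P × Q)} (h : I.IsStable μ) :
    I.IsStable I.qopt := by
  have hex := I.exists_qopt h
  unfold qopt
  rw [dif_pos hex]
  exact hex.choose_spec.1

theorem contr_stable (I : MI P Q) {μ : Finset (P × Q)} (h : I.IsStable μ) {e : P × Q}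
    (he : e ∈ μ) : (I.contr e).IsStable (μ.erase e) := by
  refine ⟨⟨?_, ?_⟩, ?_⟩
  · intro f hf
    obtain ⟨hne, hf⟩ := Finset.mem_erase.1 hf
    exact Finset.mem_filter.2 ⟨h.1.1 hf, fun h1 => hne (h.1.2 f hf e he (Or.inl h1)),
      fun h1 => hne (h.1.2 f hf e he (Or.inr h1))⟩
  · intro f hf g hg
    exact h.1.2 f (Finset.mem_of_mem_erase hf) g (Finset.mem_of_mem_erase hg)
  · rintro ⟨p, q⟩ ⟨hE, hF, hW⟩
    obtain ⟨hE, hp, hq⟩ := Finset.mem_filter.1 hE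
    refine h.2 (p, q) ⟨hE, ?_, ?_⟩
    · intro q' hq'
      refine hF q' (Finset.mem_erase.2 ⟨?_, hq'⟩)
      rintro rfl
      exact hp rfl
    · intro p' hp'
      refine hW p' (Finset.mem_erase.2 ⟨?_, hp'⟩)
      rintro rfl
      exact hq rfl

theorem sfda_images (n : ℕ) : ∀ (I : MI P Q) (σ : List (P × Q)), σ.length ≤ n →
    (∀ e ∈ I.E, e ∈ σ) → ∀ μ, I.IsStable μ →
    (I.sfda σ).image Prod.fst = μ.image Prod.fst ∧
    (I.sfda σ).image Prod.snd = μ.image Prod.snd := by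
  induction n with
  | zero =>
    intro I σ hn hσ μ hμ
    have h0 : σ = [] := List.length_eq_zero_iff.1 (Nat.le_zero.1 hn)
    subst h0
    have hm : μ = ∅ := Finset.eq_empty_of_forall_notMem
      (fun e he => List.not_mem_nil (hσ e (hμ.1.1 he)))
    subst hm
    rw [sfda]
    simp
  | succ n ih =>
    intro I σ hn hσ μ hμ
    have hq := I.qopt_stable hμ
    have hr := I.rural hq hμ
    rw [← hr.1, ← hr.2, sfda]
    split
    · next hnone =>
      have hm : I.qopt = ∅ := by
        refine Finset.eq_empty_of_forall_notMem (fun e he => ?_)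
        have := List.find?_eq_none.1 hnone e (hσ e (hq.1.1 he))
        simp [he] at this
      simp [hm]
    · next e hsome =>
      have he : e ∈ I.qopt := by simpa using List.find?_some hsome
      have heσ : e ∈ σ := List.mem_of_find?_eq_some hsome
      have hlen : (contrO σ e).length < σ.length :=
        List.length_filter_lt_length_iff_exists.mpr ⟨e, heσ, by simp⟩
      have hrec := ih (I.contr e) (contrO σ e) (by omega) (by
        intro f hf
        obtain ⟨hf, h2⟩ := Finset.mem_filter.1 hf
        exact List.mem_filter.2 ⟨hσ f hf, by simpa using h2⟩) _ (I.contr_stable hq he)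
      rw [Finset.image_insert, Finset.image_insert, hrec.1, hrec.2,
        ← Finset.image_insert, ← Finset.image_insert, Finset.insert_erase he]
      exact ⟨rfl, rfl⟩

/-- an agent is matched in `sfda(I, σ)` iff it is matched in `qopt(I)`. -/
theorem stmt_7 (P Q : Type) [DecidableEq P] [DecidableEq Q] (I : MI P Q)
    (σ : List (P × Q)) (hσ : I.IsOfferOrder σ)
    (μ₀ : Finset (P × Q)) (h₀ : I.IsQOpt μ₀) :
    (∀ p : P, (∃ q, (p, q) ∈ I.sfda σ) ↔ ∃ q, (p, q) ∈ μ₀) ∧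
    (∀ q : Q, (∃ p, (p, q) ∈ I.sfda σ) ↔ ∃ p, (p, q) ∈ μ₀) := by
  obtain ⟨h1, h2⟩ := sfda_images σ.length I σ le_rfl (fun e he => (hσ.2.1 e).2 he) μ₀ h₀.1
  constructor
  · intro p
    have := Finset.ext_iff.1 h1 p
    simpa using this
  · intro q
    have := Finset.ext_iff.1 h2 q
    simpa using this

end MI

end SeqMatching
end
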